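/- arXiv:1008.0490 — 2 statements merged into one kernel-verified Lean document; each statement's English description precedes it below -/
import Mathlib

section
/- Let v be a Delaunay solution with parameter H₀ ∈ (0, H_max). Then: (i) v is periodic, i.e. there exists T > 0 with v(t + T) = v(t) for all t ∈ ℝ; (ii) 0 < v(t) < 1 for all t ∈ ℝ; (iii) v attains its global minimum at t = 0, i.e. v(0) ≤ v(t) for all t; and (iv) the neck-size parameter η := v(0)^{2k/(n−2k)} satisfies 0 < η < ((n−2k)/n)^{1/(2k)}. -/
noncomputable section

open Real Set

/-- α = (n−2k)/(2k) -/
def alp (n k : ℕ) : ℝ := ((n : ℝ) - 2 * (k : ℝ)) / (2 * (k : ℝ))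

/-- q = 2kn/(n−2k) -/
def qe (n k : ℕ) : ℝ := (2 * (k : ℝ) * (n : ℝ)) / ((n : ℝ) - 2 * (k : ℝ))

/-- h_v(t) = v(t)² − α⁻² v′(t)² -/
def hDel (n k : ℕ) (v : ℝ → ℝ) (t : ℝ) : ℝ :=
  (v t) ^ 2 - ((alp n k)⁻¹) ^ 2 * (deriv v t) ^ 2

/-- H_v(t) = h_v(t)^k − v(t)^q -/
def HDel (n k : ℕ) (v : ℝ → ℝ) (t : ℝ) : ℝ :=
  (hDel n k v t) ^ k - (v t) ^ (qe n k)

/-- The Delaunay ODE. -/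
def DelODE (n k : ℕ) (v : ℝ → ℝ) : Prop :=
  ∀ t : ℝ, (hDel n k v t) ^ (k - 1) * (v t - ((alp n k)⁻¹) ^ 2 * deriv (deriv v) t)
    = ((n : ℝ) / ((n : ℝ) - 2 * (k : ℝ))) * (v t) ^ (qe n k - 1)

/-- H_max = (2k/(n−2k))·((n−2k)/n)^{n/(2k)} -/
def Hmax (n k : ℕ) : ℝ :=
  (2 * (k : ℝ) / ((n : ℝ) - 2 * (k : ℝ))) *
    (((n : ℝ) - 2 * (k : ℝ)) / (n : ℝ)) ^ ((n : ℝ) / (2 * (k : ℝ)))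

/-- A Delaunay solution with parameter H₀. -/
def DelSol (n k : ℕ) (H₀ : ℝ) (v : ℝ → ℝ) : Prop :=
  ContDiff ℝ (⊤ : ℕ∞) v ∧ (∀ t, 0 < v t) ∧ DelODE n k v ∧
    deriv v 0 = 0 ∧ 0 < deriv (deriv v) 0 ∧ ∀ t, HDel n k v t = H₀

/-- F(t) = v(t)^q/(H₀ + v(t)^q) -/
def FDel (n k : ℕ) (H₀ : ℝ) (v : ℝ → ℝ) (t : ℝ) : ℝ :=
  (v t) ^ (qe n k) / (H₀ + (v t) ^ (qe n k))

/-- The coefficient a(t) of the conjugate linearized operator. -/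
def aDel (n k : ℕ) (H₀ : ℝ) (v : ℝ → ℝ) (t : ℝ) : ℝ :=
  ((n : ℝ) - (k : ℝ)) / ((k : ℝ) * ((n : ℝ) - 1)) +
    ((n : ℝ) * ((k : ℝ) - 1) / ((k : ℝ) * ((n : ℝ) - 1))) * FDel n k H₀ v t

/-- The potential p(t) of the conjugate linearized operator. -/
def pDel (n k : ℕ) (H₀ : ℝ) (v : ℝ → ℝ) (t : ℝ) : ℝ :=
  (alp n k) ^ 2
  + ((n : ℝ) * ((n : ℝ) * (k : ℝ) + (n : ℝ) - 2 * (k : ℝ)) * ((k : ℝ) - 1) /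
      (2 * (k : ℝ) ^ 2)) * FDel n k H₀ v t
  - ((n : ℝ) ^ 2 * ((k : ℝ) ^ 2 - 1) / (4 * (k : ℝ) ^ 2)) * (FDel n k H₀ v t) ^ 2
  - ((n : ℝ) * (2 * (k : ℝ) * (n : ℝ) - (n : ℝ) + 2 * (k : ℝ)) / (4 * (k : ℝ))) *
      (v t) ^ (4 * (k : ℝ) / ((n : ℝ) - 2 * (k : ℝ))) *
      (FDel n k H₀ v t) ^ (((k : ℝ) - 1) / (k : ℝ))
  + ((n : ℝ) ^ 2 * (k : ℝ) * ((k : ℝ) - 1) / (4 * (k : ℝ) ^ 2)) *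
      (v t) ^ (4 * (k : ℝ) / ((n : ℝ) - 2 * (k : ℝ))) *
      (FDel n k H₀ v t) ^ ((2 * (k : ℝ) - 1) / (k : ℝ))

open Filter Topology NNReal

/-- If `f` and its derivative both converge at infinity, the derivative converges to zero. -/
theorem eq_zero_of_tendsto_of_tendsto_deriv {f f' : ℝ → ℝ} {L c : ℝ}
    (hf : ∀ t, HasDerivAt f (f' t) t) (hL : Tendsto f atTop (𝓝 L))
    (hc : Tendsto f' atTop (𝓝 c)) : c = 0 := by
  have hmv : ∀ t, ∃ s ∈ Ioo t (t + 1), f' s = f (t + 1) - f t := fun t => by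
    obtain ⟨s, hs, h⟩ := exists_hasDerivAt_eq_slope f f' (lt_add_one t)
      (fun x _ => (hf x).continuousAt.continuousWithinAt) (fun x _ => hf x)
    exact ⟨s, hs, by simpa using h⟩
  choose s hs hfs using hmv
  have hs_top : Tendsto s atTop atTop :=
    tendsto_atTop_mono (fun t => (hs t).1.le) tendsto_id
  have hdiff : Tendsto (fun t => f (t + 1) - f t) atTop (𝓝 (L - L)) :=
    (hL.comp (tendsto_atTop_add_const_right atTop 1 tendsto_id)).sub hL
  have hcomp : Tendsto (fun t => f (t + 1) - f t) atTop (𝓝 c) := by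
    simpa only [Function.comp_def, hfs] using hc.comp hs_top
  simpa using tendsto_nhds_unique hcomp hdiff

/-- A solution of `v'' = Ψ(v)` is symmetric about each of its critical points. -/
theorem reflection_of_deriv_eq_zero {Ψ v w : ℝ → ℝ} {s : Set ℝ} {K : ℝ≥0}
    (hΨ : LipschitzOnWith K Ψ s) (hv : ∀ t, HasDerivAt v (w t) t)
    (hw : ∀ t, HasDerivAt w (Ψ (v t)) t) (hs : ∀ t, v t ∈ s) {c : ℝ} (hc : w c = 0) (t : ℝ) :
    v (2 * c - t) = v t := by
  have hfield : LipschitzOnWith (max 1 (K * 1)) (fun p : ℝ × ℝ => (p.2, Ψ p.1)) (s ×ˢ univ) :=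
    LipschitzWith.prod_snd.lipschitzOnWith.prodMk
      (hΨ.comp LipschitzWith.prod_fst.lipschitzOnWith fun p hp => hp.1)
  have hrefl (t : ℝ) : HasDerivAt (fun t => 2 * c - t) (-1) t := by
    simpa using (hasDerivAt_id t).const_sub (2 * c)
  have huniq := ODE_solution_unique_univ (t₀ := c)
    (f := fun t => (v (2 * c - t), -w (2 * c - t))) (g := fun t => (v t, w t))
    (v := fun _ p => (p.2, Ψ p.1)) (s := fun _ => s ×ˢ univ)
    (fun _ => hfield)
    (fun t => ⟨by
      have h1 := (hv (2 * c - t)).comp t (hrefl t)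
      have h2 := ((hw (2 * c - t)).comp t (hrefl t)).neg
      simpa using h1.prodMk h2, hs _, mem_univ _⟩)
    (fun t => ⟨(hv t).prodMk (hw t), hs _, mem_univ _⟩)
    (by simp [two_mul, hc])
  exact congrArg Prod.fst (congrFun huniq t)

/-- A solution of `v'' = Ψ(v)`, `v'² = Q(v)` with values in `[v 0, b]` and minimum at `0` has
another critical point, unless some level above `v 0` is an equilibrium. -/
theorem exists_pos_deriv_eq_zero {Ψ Q v w : ℝ → ℝ} {b : ℝ}
    (hΨ : ContinuousOn Ψ (Icc (v 0) b)) (hQ : ContinuousOn Q (Icc (v 0) b))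
    (hv : ∀ t, HasDerivAt v (w t) t) (hw : ∀ t, HasDerivAt w (Ψ (v t)) t)
    (hwQ : ∀ t, w t ^ 2 = Q (v t)) (hs : ∀ t, v t ∈ Icc (v 0) b)
    (hne : ∀ x ∈ Ioc (v 0) b, Q x = 0 → Ψ x ≠ 0) : ∃ T > 0, w T = 0 := by
  by_contra! hnz
  have hvc : Continuous v := continuous_iff_continuousAt.2 fun t => (hv t).continuousAt
  have hpos : ∀ t > 0, 0 < w t := by
    obtain ⟨ξ, hξ, hslope⟩ := exists_hasDerivAt_eq_slope v w zero_lt_one hvc.continuousOn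
      (fun x _ => hv x)
    have hwξ : 0 < w ξ := (hnz ξ hξ.1).lt_of_le' (by
      rw [hslope]; simpa using (hs 1).1)
    intro t ht
    by_contra hneg
    obtain ⟨x, hx, hx0⟩ := isPreconnected_Ioi.intermediate_value (show t ∈ Ioi (0 : ℝ) from ht)
      (show ξ ∈ Ioi (0 : ℝ) from hξ.1)
      (fun x _ => (hw x).continuousAt.continuousWithinAt) ⟨not_lt.1 hneg, hwξ.le⟩
    exact hnz x hx hx0
  have hmono : StrictMonoOn v (Ici 0) := by
    apply strictMonoOn_of_deriv_pos (convex_Ici 0) hvc.continuousOn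
    intro x hx
    rw [interior_Ici] at hx
    exact (hv x).deriv ▸ hpos x hx
  obtain ⟨L, hL⟩ : ∃ L, Tendsto v atTop (𝓝 L) := by
    have hm : Monotone fun t => v (max t 0) := fun x y hxy =>
      hmono.monotoneOn (mem_Ici.2 (le_max_right _ _)) (mem_Ici.2 (le_max_right _ _)) (max_le_max_right 0 hxy)
    refine ⟨_, (tendsto_atTop_ciSup hm ⟨b, ?_⟩).congr' ?_⟩
    · rintro _ ⟨t, rfl⟩
      exact (hs _).2
    · filter_upwards [eventually_ge_atTop 0] with t ht
      rw [max_eq_left ht]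
  have hL0 : v 0 < L := by
    refine (hmono self_mem_Ici (mem_Ici.2 zero_le_one) zero_lt_one).trans_le (ge_of_tendsto hL ?_)
    filter_upwards [eventually_ge_atTop 1] with t ht
    exact hmono.monotoneOn (mem_Ici.2 zero_le_one) (mem_Ici.2 (zero_le_one.trans ht)) ht
  have hLb : L ≤ b := le_of_tendsto' hL fun t => (hs t).2
  have hLw : Tendsto v atTop (𝓝[Icc (v 0) b] L) :=
    tendsto_nhdsWithin_iff.2 ⟨hL, Eventually.of_forall hs⟩
  have hΨL : Tendsto (fun t => Ψ (v t)) atTop (𝓝 (Ψ L)) := (hΨ L ⟨hL0.le, hLb⟩).tendsto.comp hLw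
  have hQL : Tendsto (fun t => Q (v t)) atTop (𝓝 (Q L)) := (hQ L ⟨hL0.le, hLb⟩).tendsto.comp hLw
  have hwL : Tendsto w atTop (𝓝 √(Q L)) := by
    refine hQL.sqrt.congr' ?_
    filter_upwards [eventually_gt_atTop 0] with t ht
    rw [← hwQ, Real.sqrt_sq (hpos t ht).le]
  have hsqrt := eq_zero_of_tendsto_of_tendsto_deriv hv hL hwL
  refine hne L ⟨hL0, hLb⟩ ?_ (eq_zero_of_tendsto_of_tendsto_deriv hw hwL hΨL)
  refine le_antisymm (Real.sqrt_eq_zero'.1 hsqrt) (ge_of_tendsto' hQL fun t => ?_)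
  rw [← hwQ]
  positivity

/-- `x ↦ x ^ m - x ^ q` is strictly increasing below its critical point. -/
theorem pow_sub_rpow_lt {m : ℕ} {q a b : ℝ} (hm : 0 < m) (hq : m < q) (ha : 0 < a) (hab : a < b)
    (hb : b ^ (q - m) ≤ m / q) : a ^ m - a ^ q < b ^ m - b ^ q := by
  have hm' : (0 : ℝ) < m := Nat.cast_pos.2 hm
  have hq' : 0 < q := hm'.trans hq
  have hd : ∀ x ∈ Icc a b, HasDerivAt (fun x : ℝ => x ^ m - x ^ q)
      (m * x ^ (m - 1) - q * x ^ (q - 1)) x := fun x hx =>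
    (hasDerivAt_pow m x).sub (Real.hasDerivAt_rpow_const (Or.inl (ha.trans_le hx.1).ne'))
  have hmono : StrictMonoOn (fun x : ℝ => x ^ m - x ^ q) (Icc a b) := by
    apply strictMonoOn_of_deriv_pos (convex_Icc a b)
      (fun x hx => (hd x hx).continuousAt.continuousWithinAt)
    intro x hx
    rw [interior_Icc] at hx
    have hx0 : 0 < x := ha.trans hx.1
    rw [(hd x ⟨hx.1.le, hx.2.le⟩).deriv]
    have hlt : x ^ (q - m) < m / q :=
      (Real.rpow_lt_rpow hx0.le hx.2 (sub_pos.2 hq)).trans_le hb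
    rw [lt_div_iff₀ hq'] at hlt
    have hsplit : x ^ (q - 1) = x ^ (m - 1) * x ^ (q - m) := by
      rw [← Real.rpow_natCast, ← Real.rpow_add hx0, Nat.cast_sub hm]
      congr 1
      push_cast
      ring
    rw [hsplit, sub_pos]
    nlinarith [pow_pos hx0 (m - 1)]
  exact hmono ⟨le_rfl, hab.le⟩ ⟨hab.le, le_rfl⟩ hab

theorem alp_pos {n k : ℕ} (hk : 0 < k) (hkn : 2 * k < n) : 0 < alp n k := by
  have hk' : (0 : ℝ) < k := Nat.cast_pos.2 hk
  have hkn' : 2 * (k : ℝ) < n := by exact_mod_cast hkn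
  exact div_pos (sub_pos.2 hkn') (by positivity)

theorem two_mul_lt_qe {n k : ℕ} (hk : 0 < k) (hkn : 2 * k < n) : ((2 * k : ℕ) : ℝ) < qe n k := by
  have hk' : (0 : ℝ) < k := Nat.cast_pos.2 hk
  have hkn' : 2 * (k : ℝ) < n := by exact_mod_cast hkn
  rw [qe, lt_div_iff₀ (sub_pos.2 hkn')]
  push_cast
  nlinarith [mul_pos hk' hk']

theorem two_mul_div_qe {n k : ℕ} (hk : 0 < k) (hkn : 2 * k < n) :
    ((2 * k : ℕ) : ℝ) / qe n k = ((n : ℝ) - 2 * k) / n := by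
  have hk' : (k : ℝ) ≠ 0 := Nat.cast_ne_zero.2 hk.ne'
  have hkn' : (n : ℝ) - 2 * k ≠ 0 := (sub_pos.2 (by exact_mod_cast hkn)).ne'
  have hn : (n : ℝ) ≠ 0 := Nat.cast_ne_zero.2 (by omega)
  rw [qe]
  push_cast
  field_simp

/-- The value of `h_v` at a point where `v = x`, on the level set `H_v = H₀`. -/
def hLevel (n k : ℕ) (H₀ x : ℝ) : ℝ := (H₀ + x ^ qe n k) ^ (1 / (k : ℝ))

/-- The right-hand side of the Delaunay equation on the level set `H_v = H₀`, written as
`v'' = delForce v`. -/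
def delForce (n k : ℕ) (H₀ x : ℝ) : ℝ :=
  alp n k ^ 2 * (x - (n : ℝ) / ((n : ℝ) - 2 * k) * x ^ (qe n k - 1) *
    (hLevel n k H₀ x ^ (k - 1))⁻¹)

/-- The value of `v'²` at a point where `v = x`, on the level set `H_v = H₀`. -/
def delSpeedSq (n k : ℕ) (H₀ x : ℝ) : ℝ := alp n k ^ 2 * (x ^ 2 - hLevel n k H₀ x)

section Level

variable {n k : ℕ} {H₀ x : ℝ}

theorem hLevel_pos (hH₀ : 0 < H₀) (hx : 0 < x) : 0 < hLevel n k H₀ x :=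
  Real.rpow_pos_of_pos (add_pos hH₀ (Real.rpow_pos_of_pos hx _)) _

theorem hLevel_pow (hk : 0 < k) (hH₀ : 0 < H₀) (hx : 0 < x) :
    hLevel n k H₀ x ^ k = H₀ + x ^ qe n k := by
  rw [hLevel, one_div]
  exact Real.rpow_inv_natCast_pow (add_pos hH₀ (Real.rpow_pos_of_pos hx _)).le hk.ne'

theorem contDiffAt_hLevel (hH₀ : 0 < H₀) (hx : 0 < x) : ContDiffAt ℝ 1 (hLevel n k H₀) x :=
  (contDiffAt_const.add (contDiffAt_id.rpow_const_of_ne hx.ne')).rpow_const_of_ne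
    (add_pos hH₀ (Real.rpow_pos_of_pos hx _)).ne'

theorem contDiffAt_delForce (hH₀ : 0 < H₀) (hx : 0 < x) : ContDiffAt ℝ 1 (delForce n k H₀) x :=
  contDiffAt_const.mul (contDiffAt_id.sub ((contDiffAt_const.mul
    (contDiffAt_id.rpow_const_of_ne hx.ne')).mul
      (((contDiffAt_hLevel hH₀ hx).pow _).inv (pow_pos (hLevel_pos hH₀ hx) _).ne')))

theorem contDiffAt_delSpeedSq (hH₀ : 0 < H₀) (hx : 0 < x) :
    ContDiffAt ℝ 1 (delSpeedSq n k H₀) x :=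
  contDiffAt_const.mul ((contDiffAt_id.pow 2).sub (contDiffAt_hLevel hH₀ hx))

theorem exists_lipschitzOnWith_delForce (hH₀ : 0 < H₀) {a b : ℝ} (ha : 0 < a) :
    ∃ K, LipschitzOnWith K (delForce n k H₀) (Icc a b) :=
  LocallyLipschitzOn.exists_lipschitzOnWith_of_compact isCompact_Icc fun _ hx =>
    (contDiffAt_delForce hH₀ (ha.trans_le hx.1)).contDiffWithinAt.exists_lipschitzOnWith
      (convex_Icc a b)

/-- The derivative of `x ^ (2 k) - x ^ q` up to a positive factor. -/
theorem pow_sub_mul_rpow (hk : 0 < k) (hx : 0 < x) (c : ℝ) :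
    (x ^ 2) ^ (k - 1) * x - c * x ^ (qe n k - 1) =
      x ^ (2 * k - 1) * (1 - c * x ^ (qe n k - (2 * k : ℕ))) := by
  have h1 : (x ^ 2) ^ (k - 1) * x = x ^ (2 * k - 1) := by
    rw [← pow_mul, ← pow_succ]
    congr 1
    omega
  have h2 : x ^ (qe n k - 1) = x ^ (2 * k - 1) * x ^ (qe n k - (2 * k : ℕ)) := by
    rw [← Real.rpow_natCast, ← Real.rpow_add hx, Nat.cast_sub (by omega)]
    congr 1
    push_cast
    ring
  rw [h1, h2]
  ring

/-- A rest point of the reduced equation lies on the level set and is a critical point of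
`x ^ (2 k) - x ^ q`. -/
theorem equilibrium (hk : 0 < k) (hkn : 2 * k < n) (hH₀ : 0 < H₀) (hx : 0 < x)
    (hQ : delSpeedSq n k H₀ x = 0) (hΨ : delForce n k H₀ x = 0) :
    x ^ (2 * k) - x ^ qe n k = H₀ ∧
      x ^ (qe n k - (2 * k : ℕ)) = ((2 * k : ℕ) : ℝ) / qe n k := by
  have hα : alp n k ^ 2 ≠ 0 := (pow_pos (alp_pos hk hkn) 2).ne'
  have hlev : hLevel n k H₀ x = x ^ 2 :=
    (sub_eq_zero.1 ((mul_eq_zero.1 hQ).resolve_left hα)).symm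
  have hpow := hLevel_pow (n := n) hk hH₀ hx
  rw [hlev, ← pow_mul] at hpow
  refine ⟨by linarith, ?_⟩
  have hf := (mul_eq_zero.1 hΨ).resolve_left hα
  have hn : (n : ℝ) ≠ 0 := Nat.cast_ne_zero.2 (by omega)
  have hkn' : (n : ℝ) - 2 * k ≠ 0 := (sub_pos.2 (by exact_mod_cast hkn)).ne'
  have hcrit : (x ^ 2) ^ (k - 1) * x - (n : ℝ) / ((n : ℝ) - 2 * k) * x ^ (qe n k - 1) = 0 := by
    have hne : (x ^ 2) ^ (k - 1) ≠ 0 := by positivity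
    rw [hlev] at hf
    calc _ = (x ^ 2) ^ (k - 1) * (x - (n : ℝ) / ((n : ℝ) - 2 * k) * x ^ (qe n k - 1) *
          ((x ^ 2) ^ (k - 1))⁻¹) := by field_simp
      _ = 0 := by rw [hf, mul_zero]
  rw [pow_sub_mul_rpow hk hx] at hcrit
  have h0 := (mul_eq_zero.1 hcrit).resolve_left (by positivity)
  rw [two_mul_div_qe hk hkn, eq_div_iff hn]
  field_simp at h0
  linarith

end Level

namespace DelSol

variable {n k : ℕ} {H₀ : ℝ} {v : ℝ → ℝ}

theorem hasDerivAt (hsol : DelSol n k H₀ v) (t : ℝ) : HasDerivAt v (deriv v t) t :=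
  (hsol.1.differentiable (by simp) t).hasDerivAt

theorem hasDerivAt_deriv (hsol : DelSol n k H₀ v) (t : ℝ) :
    HasDerivAt (deriv v) (deriv (deriv v) t) t :=
  (((contDiff_infty_iff_deriv.1 hsol.1).2.differentiable (by simp)) t).hasDerivAt

theorem hDel_pow (hsol : DelSol n k H₀ v) (t : ℝ) : hDel n k v t ^ k = H₀ + v t ^ qe n k := by
  rw [← hsol.2.2.2.2.2 t, HDel]
  ring

theorem hDel_pos (hsol : DelSol n k H₀ v) (hk : 0 < k) (hH₀ : 0 < H₀) (t : ℝ) :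
    0 < hDel n k v t := by
  have hne : ∀ s, hDel n k v s ≠ 0 := fun s h0 => by
    have h := hsol.hDel_pow s
    rw [h0, zero_pow hk.ne'] at h
    linarith [Real.rpow_pos_of_pos (hsol.2.1 s) (qe n k)]
  have hcont : Continuous (hDel n k v) := by
    have h1 := hsol.1.continuous
    have h2 := (contDiff_infty_iff_deriv.1 hsol.1).2.continuous
    unfold hDel
    fun_prop
  have h0 : 0 < hDel n k v 0 := by
    rw [hDel, hsol.2.2.2.1]
    simpa using pow_pos (hsol.2.1 0) 2
  by_contra hneg
  obtain ⟨s, hs⟩ := mem_range_of_exists_le_of_exists_ge hcont ⟨t, not_lt.1 hneg⟩ ⟨0, h0.le⟩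
  exact hne s hs

theorem hDel_eq (hsol : DelSol n k H₀ v) (hk : 0 < k) (hH₀ : 0 < H₀) (t : ℝ) :
    hDel n k v t = hLevel n k H₀ (v t) := by
  refine (pow_left_inj₀ (hsol.hDel_pos hk hH₀ t).le (hLevel_pos hH₀ (hsol.2.1 t)).le hk.ne').1 ?_
  rw [hsol.hDel_pow, hLevel_pow hk hH₀ (hsol.2.1 t)]

theorem deriv_sq_eq (hsol : DelSol n k H₀ v) (hk : 0 < k) (hkn : 2 * k < n) (hH₀ : 0 < H₀)
    (t : ℝ) : deriv v t ^ 2 = delSpeedSq n k H₀ (v t) := by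
  have hα := (alp_pos hk hkn).ne'
  rw [delSpeedSq, ← hsol.hDel_eq hk hH₀, hDel]
  field_simp
  ring

theorem deriv_deriv_eq (hsol : DelSol n k H₀ v) (hk : 0 < k) (hkn : 2 * k < n) (hH₀ : 0 < H₀)
    (t : ℝ) : deriv (deriv v) t = delForce n k H₀ (v t) := by
  have hα := (alp_pos hk hkn).ne'
  have hh := (pow_pos (hsol.hDel_pos hk hH₀ t) (k - 1)).ne'
  rw [delForce, ← hsol.hDel_eq hk hH₀, ← hsol.2.2.1 t, mul_comm (_ ^ (k - 1)), mul_assoc,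
    mul_inv_cancel₀ hh]
  field_simp
  ring

theorem le_pow_sub_rpow (hsol : DelSol n k H₀ v) (hk : 0 < k) (hH₀ : 0 < H₀) (t : ℝ) :
    H₀ ≤ v t ^ (2 * k) - v t ^ qe n k := by
  have h : hDel n k v t ^ k ≤ (v t ^ 2) ^ k := by
    refine pow_le_pow_left₀ (hsol.hDel_pos hk hH₀ t).le ?_ k
    rw [hDel, sub_le_self_iff]
    positivity
  rw [hsol.hDel_pow, ← pow_mul] at h
  linarith

theorem pow_sub_rpow_zero (hsol : DelSol n k H₀ v) :
    v 0 ^ (2 * k) - v 0 ^ qe n k = H₀ := by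
  have h := hsol.hDel_pow 0
  rw [hDel, hsol.2.2.2.1, zero_pow two_ne_zero, mul_zero, sub_zero, ← pow_mul] at h
  linarith

theorem lt_one (hsol : DelSol n k H₀ v) (hk : 0 < k) (hkn : 2 * k < n) (hH₀ : 0 < H₀) (t : ℝ) :
    v t < 1 := by
  by_contra! hge
  have h := Real.rpow_le_rpow_of_exponent_le hge (two_mul_lt_qe hk hkn).le
  rw [Real.rpow_natCast] at h
  linarith [hsol.le_pow_sub_rpow hk hH₀ t]

theorem rpow_zero_lt (hsol : DelSol n k H₀ v) (hk : 0 < k) (hkn : 2 * k < n) :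
    v 0 ^ (qe n k - (2 * k : ℕ)) < ((2 * k : ℕ) : ℝ) / qe n k := by
  have hv := hsol.2.1 0
  have hα := alp_pos hk hkn
  have hn : (0 : ℝ) < n := Nat.cast_pos.2 (by omega)
  have hkn' : (0 : ℝ) < (n : ℝ) - 2 * k := sub_pos.2 (by exact_mod_cast hkn)
  have hode := hsol.2.2.1 0
  rw [hDel, hsol.2.2.2.1, zero_pow two_ne_zero, mul_zero, sub_zero] at hode
  have hpos : 0 < (v 0 ^ 2) ^ (k - 1) * ((alp n k)⁻¹ ^ 2 * deriv (deriv v) 0) :=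
    mul_pos (by positivity) (mul_pos (by positivity) hsol.2.2.2.2.1)
  have hcrit : 0 < (v 0 ^ 2) ^ (k - 1) * v 0 -
      (n : ℝ) / ((n : ℝ) - 2 * k) * v 0 ^ (qe n k - 1) := by linarith
  rw [pow_sub_mul_rpow hk hv] at hcrit
  have h := pos_of_mul_pos_right hcrit (by positivity)
  rw [two_mul_div_qe hk hkn, lt_div_iff₀ hn]
  rw [div_mul_eq_mul_div, sub_pos, div_lt_one hkn'] at h
  linarith

theorem zero_le (hsol : DelSol n k H₀ v) (hk : 0 < k) (hkn : 2 * k < n) (hH₀ : 0 < H₀) (t : ℝ) :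
    v 0 ≤ v t := by
  by_contra! hlt
  have h := pow_sub_rpow_lt (by omega : 0 < 2 * k) (two_mul_lt_qe hk hkn) (hsol.2.1 t) hlt
    (hsol.rpow_zero_lt hk hkn).le
  rw [hsol.pow_sub_rpow_zero] at h
  exact (hsol.le_pow_sub_rpow hk hH₀ t).not_gt h

theorem periodic (hsol : DelSol n k H₀ v) (hk : 0 < k) (hkn : 2 * k < n) (hH₀ : 0 < H₀) :
    ∃ T > (0 : ℝ), ∀ t, v (t + T) = v t := by
  have hv0 := hsol.2.1 0
  have hmem (t : ℝ) : v t ∈ Icc (v 0) 1 :=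
    ⟨hsol.zero_le hk hkn hH₀ t, (hsol.lt_one hk hkn hH₀ t).le⟩
  have hw (t : ℝ) : HasDerivAt (deriv v) (delForce n k H₀ (v t)) t :=
    hsol.deriv_deriv_eq hk hkn hH₀ t ▸ hsol.hasDerivAt_deriv t
  obtain ⟨K, hK⟩ := exists_lipschitzOnWith_delForce (n := n) (k := k) hH₀ (b := 1) hv0
  obtain ⟨T, hT, hwT⟩ := exists_pos_deriv_eq_zero hK.continuousOn
    (fun x hx => (contDiffAt_delSpeedSq hH₀ (hv0.trans_le hx.1)).continuousAt.continuousWithinAt)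
    hsol.hasDerivAt hw (hsol.deriv_sq_eq hk hkn hH₀) hmem
    (fun x hx hQ hΨ => by
      obtain ⟨hlev, hcrit⟩ := equilibrium hk hkn hH₀ (hv0.trans hx.1) hQ hΨ
      have h := pow_sub_rpow_lt (by omega : 0 < 2 * k) (two_mul_lt_qe hk hkn) hv0 hx.1 hcrit.le
      rw [hsol.pow_sub_rpow_zero, hlev] at h
      exact h.false)
  refine ⟨2 * T, by positivity, fun t => ?_⟩
  have h0 := reflection_of_deriv_eq_zero hK hsol.hasDerivAt hw hmem hsol.2.2.2.1 t
  have h1 := reflection_of_deriv_eq_zero hK hsol.hasDerivAt hw hmem hwT (-t)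
  rw [sub_neg_eq_add, add_comm] at h1
  rw [h1, ← h0, mul_zero, zero_sub]

theorem neckSize_lt (hsol : DelSol n k H₀ v) (hk : 0 < k) (hkn : 2 * k < n) :
    v 0 ^ (2 * (k : ℝ) / ((n : ℝ) - 2 * k)) <
      (((n : ℝ) - 2 * k) / n) ^ (1 / (2 * (k : ℝ))) := by
  have hv := (hsol.2.1 0).le
  have hk' : (0 : ℝ) < k := Nat.cast_pos.2 hk
  have hkn' : (n : ℝ) - 2 * k ≠ 0 := (sub_pos.2 (by exact_mod_cast hkn)).ne'
  have h := Real.rpow_lt_rpow (Real.rpow_nonneg hv _) (hsol.rpow_zero_lt hk hkn)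
    (by positivity : 0 < 1 / (2 * (k : ℝ)))
  rw [two_mul_div_qe hk hkn, ← Real.rpow_mul hv] at h
  convert h using 2
  rw [qe]
  push_cast
  field_simp
  ring

end DelSol

/-- qualitative properties of Delaunay solutions: periodicity, bounds,
minimum at 0, and the range of the neck-size parameter. -/
theorem delaunay_properties (n k : ℕ) (hk : 2 ≤ 2 * k) (hkn : 2 * k < n)
    (H₀ : ℝ) (hH₀ : 0 < H₀) (hH₁ : H₀ < Hmax n k)
    (v : ℝ → ℝ) (hsol : DelSol n k H₀ v) :
    (∃ T > (0 : ℝ), ∀ t, v (t + T) = v t) ∧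
    (∀ t, 0 < v t ∧ v t < 1) ∧
    (∀ t, v 0 ≤ v t) ∧
    (0 < (v 0) ^ (2 * (k : ℝ) / ((n : ℝ) - 2 * (k : ℝ))) ∧
      (v 0) ^ (2 * (k : ℝ) / ((n : ℝ) - 2 * (k : ℝ))) <
        (((n : ℝ) - 2 * (k : ℝ)) / (n : ℝ)) ^ ((1 : ℝ) / (2 * (k : ℝ)))) := by
  have hk' : 0 < k := by omega
  exact ⟨hsol.periodic hk' hkn hH₀, fun t => ⟨hsol.2.1 t, hsol.lt_one hk' hkn hH₀ t⟩,
    hsol.zero_le hk' hkn hH₀, Real.rpow_pos_of_pos (hsol.2.1 0) _, hsol.neckSize_lt hk' hkn⟩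
end
end

section
/- Let v be a Delaunay solution with parameter H₀ ∈ (0, H_max) and let p be the associated potential. Then the conjugate Jacobi field Φ(t) := h_v(t)^{(k−1)/2} · v′(t) satisfies the second-order ODE Φ″(t) = p(t)·Φ(t) for all t ∈ ℝ. -/
noncomputable section

open Real Set

/-- Derivative of a real power along a positive function, in logarithmic form. -/
lemma HasDerivAt.rpow_const_of_pos {f : ℝ → ℝ} {f' t : ℝ} (hf : HasDerivAt f f' t)
    (hpos : 0 < f t) (p : ℝ) :
    HasDerivAt (fun s => f s ^ p) (f t ^ p * (p * (f' / f t))) t := by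
  refine (hf.rpow_const (p := p) (Or.inl hpos.ne')).congr_deriv ?_
  rw [Real.rpow_sub_one hpos.ne']
  ring

/-- The second derivative of `h ^ ((K - 1) / 2) * w` for a first-order system in which
`G` and `F = G v² / h` are the nonlinear quantities. -/
lemma deriv_deriv_conjugate_of_system {v w h G F : ℝ → ℝ} {A c K : ℝ} (hA : A ≠ 0)
    (hv0 : ∀ t, 0 < v t) (hh0 : ∀ t, 0 < h t)
    (hh : ∀ t, h t = v t ^ 2 - A⁻¹ * w t ^ 2)
    (hF : ∀ t, F t = G t * v t ^ 2 / h t)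
    (hv : ∀ t, HasDerivAt v (w t) t)
    (hw : ∀ t, HasDerivAt w (A * v t * (1 - c * G t)) t)
    (hG : ∀ t, HasDerivAt G
      (G t * (w t / v t) * (2 * K * c - 2 - 2 * (K - 1) * c * F t)) t) (t : ℝ) :
    deriv (deriv (fun s => h s ^ ((K - 1) / 2) * w s)) t =
      A * (1 + (K - 1) * c * (2 * K * c + 2) * F t - (K ^ 2 - 1) * c ^ 2 * F t ^ 2
        - K * c * (2 * K * c - 1) * G t + K * (K - 1) * c ^ 2 * (G t * F t)) *
      (h t ^ ((K - 1) / 2) * w t) := by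
  have dh (s : ℝ) : HasDerivAt h (2 * c * v s * w s * G s) s := by
    have e : h = fun s => v s ^ 2 - A⁻¹ * w s ^ 2 := funext hh
    rw [e]
    refine (((hv s).fun_pow 2).fun_sub (((hw s).fun_pow 2).const_mul A⁻¹)).congr_deriv ?_
    field_simp
    ring
  have dP (s : ℝ) := (dh s).rpow_const_of_pos (hh0 s) ((K - 1) / 2)
  have dF (s : ℝ) : HasDerivAt F (F s * (w s / v s) * (2 * K * c * (1 - F s))) s := by
    have e : F = fun s => G s * v s ^ 2 / h s := funext hF
    have hvs := (hv0 s).ne'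
    have hhs := (hh0 s).ne'
    have := ((hG s).fun_mul ((hv s).fun_pow 2)).fun_div (dh s) hhs
    rw [← e] at this
    refine this.congr_deriv ?_
    rw [hF s]
    field_simp
    ring
  have first : deriv (fun s => h s ^ ((K - 1) / 2) * w s) = fun s =>
      h s ^ ((K - 1) / 2) *
        ((K - 1) * c * (F s * (w s ^ 2 / v s)) + A * v s * (1 - c * G s)) := by
    funext s
    have hvs := (hv0 s).ne'
    have hhs := (hh0 s).ne'
    rw [((dP s).fun_mul (hw s)).deriv, hF s]
    field_simp
  rw [first]
  have hvt := (hv0 t).ne'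
  have hht := (hh0 t).ne'
  have key := (dP t).fun_mul
    ((((dF t).fun_mul (((hw t).fun_pow 2).fun_div (hv t) hvt)).const_mul ((K - 1) * c)).fun_add
      (((hv t).const_mul A).fun_mul (((hG t).const_mul c).const_sub 1)))
  rw [key.deriv]
  have hFw : F t * w t ^ 2 = A * v t ^ 2 * (F t - G t) := by
    have h1 : A⁻¹ * w t ^ 2 = v t ^ 2 - h t := by linarith [hh t]
    have h2 : w t ^ 2 = A * (v t ^ 2 - h t) := by rw [← h1]; field_simp
    rw [h2, hF t]
    field_simp
  have hFu : F t * (w t / v t) ^ 2 = A * (F t - G t) := by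
    rw [div_pow, ← mul_div_assoc, hFw]; field_simp
  have hL : 2 * c * v t * w t * G t / h t = 2 * c * F t * (w t / v t) := by
    rw [hF t]; field_simp
  rw [hL]
  obtain ⟨u, hu⟩ : ∃ u, u = w t / v t := ⟨_, rfl⟩
  have hwu : w t = u * v t := by rw [hu]; field_simp
  rw [← hu] at hFu
  rw [hwu]
  generalize F t = f at *
  generalize G t = g at *
  generalize v t = x at *
  field_simp
  linear_combination h t ^ ((K - 1) / 2) * u * x * (c - K * c - 2 * K * c ^ 2 + 2 * K ^ 2 * c ^ 2
    - K ^ 2 * c ^ 2 * f + c ^ 2 * f) * hFu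

/-- The bracket `v² - α⁻² v'²` of a Delaunay solution is positive. -/
lemma DelSol.hDel_pos_s13 {n k : ℕ} {H₀ : ℝ} {v : ℝ → ℝ} (hk : k ≠ 0) (hH₀ : 0 < H₀)
    (hsol : DelSol n k H₀ v) (t : ℝ) : 0 < hDel n k v t := by
  obtain ⟨hsm, hpos, -, hv0, -, hH⟩ := hsol
  have hcont : Continuous (hDel n k v) := by
    have h1 : Continuous (deriv v) := hsm.continuous_deriv (by simp)
    have h2 : Continuous v := hsm.continuous
    unfold hDel
    fun_prop
  have hne (s : ℝ) : hDel n k v s ≠ 0 := by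
    intro h0
    have := hH s
    rw [HDel, h0, zero_pow hk] at this
    have := Real.rpow_pos_of_pos (hpos s) (qe n k)
    linarith
  have h00 : 0 < hDel n k v 0 := by
    have := hpos 0
    simp only [hDel, hv0]
    nlinarith
  by_contra! hneg
  obtain ⟨s, hs⟩ := mem_range_of_exists_le_of_exists_ge hcont ⟨t, hneg⟩ ⟨0, h00.le⟩
  exact hne s hs

/-- the conjugate Jacobi field Φ = h^{(k−1)/2}·v′ lies in the kernel of
the zero-frequency projection z ↦ z″ − p·z of the conjugate linearized operator. -/
theorem conjugate_jacobi_field_kernel (n k : ℕ) (hk : 2 ≤ 2 * k) (hkn : 2 * k < n)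
    (H₀ : ℝ) (hH₀ : 0 < H₀) (hH₁ : H₀ < Hmax n k)
    (v : ℝ → ℝ) (hsol : DelSol n k H₀ v) :
    ∀ t : ℝ,
      deriv (deriv (fun s => (hDel n k v s) ^ (((k : ℝ) - 1) / 2) * deriv v s)) t =
        pDel n k H₀ v t * ((hDel n k v t) ^ (((k : ℝ) - 1) / 2) * deriv v t) := by
  have hk0 : k ≠ 0 := by omega
  have hhpos := hsol.hDel_pos_s13 hk0 hH₀
  obtain ⟨hsm, hpos, hode, -, -, hH⟩ := hsol
  have hKpos : (0 : ℝ) < k := by exact_mod_cast Nat.pos_of_ne_zero hk0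
  have hD : (0 : ℝ) < (n : ℝ) - 2 * k := by
    have : (2 * k : ℝ) < n := by exact_mod_cast hkn
    linarith
  have hn : (0 : ℝ) < n := by linarith
  have hα : 0 < alp n k := by unfold alp; positivity
  set c : ℝ := (n : ℝ) / ((n : ℝ) - 2 * k) with hc
  have hq : qe n k = 2 * k * c := by rw [qe, hc]; field_simp
  set h := hDel n k v with hh
  have hpow (p s : ℝ) : 0 < v s ^ p := Real.rpow_pos_of_pos (hpos s) p
  have hhk (s : ℝ) : h s ^ (k : ℝ) = H₀ + v s ^ qe n k := by
    have := hH s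
    rw [HDel, ← hh] at this
    rw [Real.rpow_natCast]
    linarith
  have hvd : ContDiff ℝ 1 (deriv v) :=
    ((contDiff_succ_iff_deriv (n := 1)).1 (hsm.of_le (by norm_cast))).2.2
  have hv (s : ℝ) : HasDerivAt v (deriv v s) s :=
    (hsm.differentiable (by simp)).differentiableAt.hasDerivAt
  let G : ℝ → ℝ := fun s => v s ^ (qe n k - 2) * h s ^ (1 - (k : ℝ))
  have hFG (s : ℝ) : FDel n k H₀ v s = G s * v s ^ 2 / h s := by
    have e1 : v s ^ qe n k = v s ^ (qe n k - 2) * v s ^ 2 := by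
      rw [← Real.rpow_natCast, ← Real.rpow_add (hpos s)]; norm_num
    have e2 : h s ^ (1 - (k : ℝ)) = h s / h s ^ (k : ℝ) := by
      rw [Real.rpow_sub (hhpos s), Real.rpow_one]
    have h3 := (hhpos s).ne'
    have h4 := (Real.rpow_pos_of_pos (hhpos s) (k : ℝ)).ne'
    rw [FDel, ← hhk]
    simp only [G]
    rw [e1, e2]
    field_simp
  have hw (s : ℝ) : HasDerivAt (deriv v) (alp n k ^ 2 * v s * (1 - c * G s)) s := by
    refine (hvd.differentiable (by simp)).differentiableAt.hasDerivAt.congr_deriv ?_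
    have e := hode s
    rw [← hc, ← hh] at e
    have e1 : v s ^ (qe n k - 1) = v s ^ (qe n k - 2) * v s := by
      rw [← Real.rpow_add_one (hpos s).ne']; ring_nf
    have e2 : h s ^ (1 - (k : ℝ)) = (h s ^ (k - 1))⁻¹ := by
      rw [← Real.rpow_natCast, ← Real.rpow_neg (hhpos s).le, Nat.cast_pred (by omega)]
      ring_nf
    have h3 : h s ^ (k - 1) ≠ 0 := (pow_pos (hhpos s) _).ne'
    have hα' := hα.ne'
    rw [e1] at e
    simp only [G]
    rw [e2]
    have e4 : v s - (alp n k)⁻¹ ^ 2 * deriv (deriv v) s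
        = c * (v s ^ (qe n k - 2) * v s) / h s ^ (k - 1) := by
      rw [← e]; field_simp
    have e5 : deriv (deriv v) s = alp n k ^ 2 *
        (v s - (v s - (alp n k)⁻¹ ^ 2 * deriv (deriv v) s)) := by field_simp; ring
    rw [e5, e4]
    field_simp
  have hhA (s : ℝ) : h s = v s ^ 2 - (alp n k ^ 2)⁻¹ * deriv v s ^ 2 := by
    rw [hh, hDel, inv_pow]
  have hdh (s : ℝ) : HasDerivAt h (2 * c * v s * deriv v s * G s) s := by
    rw [funext hhA]
    refine (((hv s).fun_pow 2).fun_sub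
      (((hw s).fun_pow 2).const_mul (alp n k ^ 2)⁻¹)).congr_deriv ?_
    field_simp
    ring
  have hG (s : ℝ) : HasDerivAt G (G s * (deriv v s / v s) *
      (2 * k * c - 2 - 2 * (k - 1) * c * FDel n k H₀ v s)) s := by
    have h1 := (hpos s).ne'
    have h2 := (hhpos s).ne'
    refine (((hv s).rpow_const_of_pos (hpos s) (qe n k - 2)).fun_mul
      ((hdh s).rpow_const_of_pos (hhpos s) (1 - (k : ℝ)))).congr_deriv ?_
    rw [hFG, hq]
    have e : G s = v s ^ (2 * k * c - 2) * h s ^ (1 - (k : ℝ)) := by simp only [G, hq]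
    rw [e]
    field_simp
    ring
  intro t
  rw [deriv_deriv_conjugate_of_system (pow_ne_zero 2 hα.ne') hpos hhpos hhA hFG hv hw hG t]
  congr 1
  have hFpos : 0 < FDel n k H₀ v t := by
    have := hpow (qe n k) t
    unfold FDel
    positivity
  have hE : v t ^ (4 * (k : ℝ) / ((n : ℝ) - 2 * k)) *
      FDel n k H₀ v t ^ (((k : ℝ) - 1) / k) = G t := by
    rw [FDel, ← hhk, Real.div_rpow (hpow _ t).le (Real.rpow_pos_of_pos (hhpos t) _).le,
      ← Real.rpow_mul (hpos t).le, ← Real.rpow_mul (hhpos t).le, ← mul_div_assoc,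
      ← Real.rpow_add (hpos t), div_eq_mul_inv, ← Real.rpow_neg (hhpos t).le]
    simp only [G]
    congr 2
    · have hD0 := hD.ne'
      rw [qe]
      generalize hd : (n : ℝ) - 2 * k = d at hD0 ⊢
      have hnd : (n : ℝ) = d + 2 * k := by linarith
      field_simp
      rw [hnd]
      ring
    · field_simp; ring
  have hE2 : FDel n k H₀ v t ^ ((2 * (k : ℝ) - 1) / k) =
      FDel n k H₀ v t ^ (((k : ℝ) - 1) / k) * FDel n k H₀ v t := by
    rw [← Real.rpow_add_one hFpos.ne']
    congr 1
    field_simp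
    ring
  have hp : pDel n k H₀ v t = alp n k ^ 2
      + (n * (n * k + n - 2 * k) * (k - 1) / (2 * k ^ 2)) * FDel n k H₀ v t
      - (n ^ 2 * (k ^ 2 - 1) / (4 * k ^ 2)) * FDel n k H₀ v t ^ 2
      - (n * (2 * k * n - n + 2 * k) / (4 * k)) * G t
      + (n ^ 2 * k * (k - 1) / (4 * k ^ 2)) * (G t * FDel n k H₀ v t) := by
    rw [pDel, hE2, ← hE]
    ring
  rw [hp, hc, alp]
  generalize FDel n k H₀ v t = f
  generalize G t = g
  field_simp
  ring
end
end
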